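/- arXiv:math/0111208 — 5 statements merged into one kernel-verified Lean document; each statement's English description precedes it below -/
import Mathlib

section
/- Let U ⊆ ℝ² be open, let λ be a nonzero real constant, and let z, z̄ : U → ℝ be C² functions satisfying the Bäcklund system z_x + z̄_x = λ·sin(z − z̄) and z_y − z̄_y = (1/λ)·sin(z + z̄) at every point of U. Then both z and z̄ are solutions of the sine-Gordon equation: z_{xy} = (1/2)·sin(2z) and z̄_{xy} = (1/2)·sin(2z̄) on U. -/
theorem HasFDerivAt.hasDerivAt_slice_fst {f : ℝ × ℝ → ℝ} {f' : ℝ × ℝ →L[ℝ] ℝ} {p : ℝ × ℝ}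
    (h : HasFDerivAt f f' p) : HasDerivAt (fun x => f (x, p.2)) (f' (1, 0)) p.1 :=
  HasFDerivAt.comp_hasDerivAt (f := fun x : ℝ => (x, p.2)) p.1 h
    ((hasDerivAt_id p.1).prodMk (hasDerivAt_const p.1 p.2))

theorem HasFDerivAt.hasDerivAt_slice_snd {f : ℝ × ℝ → ℝ} {f' : ℝ × ℝ →L[ℝ] ℝ} {p : ℝ × ℝ}
    (h : HasFDerivAt f f' p) : HasDerivAt (fun y => f (p.1, y)) (f' (0, 1)) p.2 :=
  HasFDerivAt.comp_hasDerivAt (f := fun y : ℝ => (p.1, y)) p.2 h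
    ((hasDerivAt_const p.2 p.1).prodMk (hasDerivAt_id p.2))

theorem IsOpen.eventually_slice_fst {U : Set (ℝ × ℝ)} (hU : IsOpen U) {p : ℝ × ℝ} (hp : p ∈ U) :
    ∀ᶠ x in nhds p.1, (x, p.2) ∈ U :=
  ContinuousAt.eventually_mem (f := fun x : ℝ => (x, p.2)) (by fun_prop) (hU.mem_nhds hp)

theorem IsOpen.eventually_slice_snd {U : Set (ℝ × ℝ)} (hU : IsOpen U) {p : ℝ × ℝ} (hp : p ∈ U) :
    ∀ᶠ y in nhds p.2, (p.1, y) ∈ U :=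
  ContinuousAt.eventually_mem (f := fun y : ℝ => (p.1, y)) (by fun_prop) (hU.mem_nhds hp)

section MixedPartials

variable {f : ℝ × ℝ → ℝ} {U : Set (ℝ × ℝ)} {p : ℝ × ℝ}

theorem ContDiffOn.hasFDerivAt_of_isOpen (hf : ContDiffOn ℝ 2 f U) (hU : IsOpen U) (hp : p ∈ U) :
    HasFDerivAt f (fderiv ℝ f p) p :=
  ((hf.contDiffAt (hU.mem_nhds hp)).differentiableAt (by norm_num)).hasFDerivAt

theorem ContDiffOn.hasFDerivAt_fderiv_apply (hf : ContDiffOn ℝ 2 f U) (hU : IsOpen U)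
    (hp : p ∈ U) (v : ℝ × ℝ) :
    HasFDerivAt (fun q => fderiv ℝ f q v) ((fderiv ℝ (fderiv ℝ f) p).flip v) p := by
  have h : HasFDerivAt (fderiv ℝ f) (fderiv ℝ (fderiv ℝ f) p) p :=
    (((hf.contDiffAt (hU.mem_nhds hp)).fderiv_right (m := 1) (by norm_num)).differentiableAt
      (by norm_num)).hasFDerivAt
  exact (ContinuousLinearMap.apply ℝ ℝ v).hasFDerivAt.comp p h

/-- The mixed partial derivative, differentiating first in `x` and then in `y`. -/
theorem ContDiffOn.hasDerivAt_deriv_fst (hf : ContDiffOn ℝ 2 f U) (hU : IsOpen U) (hp : p ∈ U) :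
    HasDerivAt (fun y => deriv (fun x => f (x, y)) p.1)
      (fderiv ℝ (fderiv ℝ f) p (0, 1) (1, 0)) p.2 := by
  refine (hf.hasFDerivAt_fderiv_apply hU hp (1, 0)).hasDerivAt_slice_snd.congr_of_eventuallyEq ?_
  filter_upwards [hU.eventually_slice_snd hp] with y hy
  exact (hf.hasFDerivAt_of_isOpen hU hy).hasDerivAt_slice_fst.deriv

/-- The mixed partial derivative, differentiating first in `y` and then in `x`, agrees with the one
in the other order. -/
theorem ContDiffOn.hasDerivAt_deriv_snd (hf : ContDiffOn ℝ 2 f U) (hU : IsOpen U) (hp : p ∈ U) :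
    HasDerivAt (fun x => deriv (fun y => f (x, y)) p.2)
      (fderiv ℝ (fderiv ℝ f) p (0, 1) (1, 0)) p.1 := by
  have hsymm : IsSymmSndFDerivAt ℝ f p :=
    (hf.contDiffAt (hU.mem_nhds hp)).isSymmSndFDerivAt (by simp)
  rw [hsymm.eq]
  refine (hf.hasFDerivAt_fderiv_apply hU hp (0, 1)).hasDerivAt_slice_fst.congr_of_eventuallyEq ?_
  filter_upwards [hU.eventually_slice_fst hp] with x hx
  exact (hf.hasFDerivAt_of_isOpen hU hx).hasDerivAt_slice_snd.deriv

end MixedPartials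

/-- If a pair (z, z̄) of C² functions on an open set U ⊆ ℝ² satisfies the
Bäcklund system z_x + z̄_x = λ·sin(z − z̄), z_y − z̄_y = (1/λ)·sin(z + z̄), then both z and z̄
solve the sine-Gordon equation z_{xy} = (1/2)·sin(2z). -/
theorem backlund_implies_sineGordon
    (U : Set (ℝ × ℝ)) (hU : IsOpen U) (lam : ℝ) (hlam : lam ≠ 0)
    (z zbar : ℝ × ℝ → ℝ)
    (hz : ContDiffOn ℝ 2 z U) (hzbar : ContDiffOn ℝ 2 zbar U)
    (hBx : ∀ p ∈ U,
      deriv (fun x => z (x, p.2)) p.1 + deriv (fun x => zbar (x, p.2)) p.1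
        = lam * Real.sin (z p - zbar p))
    (hBy : ∀ p ∈ U,
      deriv (fun y => z (p.1, y)) p.2 - deriv (fun y => zbar (p.1, y)) p.2
        = (1 / lam) * Real.sin (z p + zbar p)) :
    (∀ p ∈ U,
      deriv (fun y => deriv (fun x => z (x, y)) p.1) p.2
        = (1 / 2) * Real.sin (2 * z p)) ∧
    (∀ p ∈ U,
      deriv (fun y => deriv (fun x => zbar (x, y)) p.1) p.2
        = (1 / 2) * Real.sin (2 * zbar p)) := by
  have key : ∀ p ∈ U,
      deriv (fun y => deriv (fun x => z (x, y)) p.1) p.2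
          + deriv (fun y => deriv (fun x => zbar (x, y)) p.1) p.2
        = Real.cos (z p - zbar p) * Real.sin (z p + zbar p) ∧
      deriv (fun y => deriv (fun x => z (x, y)) p.1) p.2
          - deriv (fun y => deriv (fun x => zbar (x, y)) p.1) p.2
        = Real.cos (z p + zbar p) * Real.sin (z p - zbar p) := by
    intro p hp
    have dz := hz.hasFDerivAt_of_isOpen hU hp
    have dzbar := hzbar.hasFDerivAt_of_isOpen hU hp
    have hx := hBx p hp
    have hy := hBy p hp
    rw [dz.hasDerivAt_slice_fst.deriv, dzbar.hasDerivAt_slice_fst.deriv] at hx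
    rw [dz.hasDerivAt_slice_snd.deriv, dzbar.hasDerivAt_slice_snd.deriv] at hy
    rw [(hz.hasDerivAt_deriv_fst hU hp).deriv, (hzbar.hasDerivAt_deriv_fst hU hp).deriv]
    constructor
    · have hL := (hz.hasDerivAt_deriv_fst hU hp).add (hzbar.hasDerivAt_deriv_fst hU hp)
      have hR := (dz.hasDerivAt_slice_snd.sub dzbar.hasDerivAt_slice_snd).sin.const_mul lam
      have e := hL.unique (hR.congr_of_eventuallyEq (by
        filter_upwards [hU.eventually_slice_snd hp] with y hy
        exact hBx (p.1, y) hy))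
      rw [e, hy]
      simp only [Pi.sub_apply, Prod.mk.eta]
      field_simp
    · have hL := (hz.hasDerivAt_deriv_snd hU hp).sub (hzbar.hasDerivAt_deriv_snd hU hp)
      have hR := (dz.hasDerivAt_slice_fst.add dzbar.hasDerivAt_slice_fst).sin.const_mul (1 / lam)
      have e := hL.unique (hR.congr_of_eventuallyEq (by
        filter_upwards [hU.eventually_slice_fst hp] with x hx
        exact hBy (x, p.2) hx))
      rw [e, hx]
      simp only [Pi.add_apply, Prod.mk.eta]
      field_simp
  refine ⟨fun p hp => ?_, fun p hp => ?_⟩ <;>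
  · obtain ⟨h₁, h₂⟩ := key p hp
    have hsum := Real.sin_add (z p + zbar p) (z p - zbar p)
    have hdiff := Real.sin_sub (z p + zbar p) (z p - zbar p)
    ring_nf at h₁ h₂ hsum hdiff ⊢
    linarith
end

section
/- Let λ be a nonzero real constant and c ∈ ℝ, and define z̄ : ℝ² → ℝ by z̄(x,y) = 2·arctan(exp(−(λ·x + y/λ + c))). Then z̄_x = −λ·sin(z̄) and z̄_y = −(1/λ)·sin(z̄) at every point (so the pair (z, z̄) with z ≡ 0 satisfies the Bäcklund system), and consequently z̄ is a solution of the sine-Gordon equation z̄_{xy} = (1/2)·sin(2z̄) (a 1-soliton solution). -/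
theorem Real.sin_two_mul_arctan (t : ℝ) :
    Real.sin (2 * Real.arctan t) = 2 * t / (1 + t ^ 2) := by
  have h : 0 < 1 + t ^ 2 := by positivity
  have hs : √(1 + t ^ 2) ^ 2 = 1 + t ^ 2 := Real.sq_sqrt h.le
  have hs0 : √(1 + t ^ 2) ≠ 0 := (Real.sqrt_pos.2 h).ne'
  rw [Real.sin_two_mul, Real.sin_arctan, Real.cos_arctan]
  field_simp
  rw [hs]

theorem HasDerivAt.two_mul_arctan_exp {u : ℝ → ℝ} {u' x : ℝ} (hu : HasDerivAt u u' x) :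
    HasDerivAt (fun t => 2 * Real.arctan (Real.exp (u t)))
      (u' * Real.sin (2 * Real.arctan (Real.exp (u x)))) x := by
  refine (hu.exp.arctan.const_mul 2).congr_deriv ?_
  rw [Real.sin_two_mul_arctan]
  ring


/-- The 1-soliton z̄(x,y) = 2·arctan(exp(−(λx + y/λ + c))) satisfies
z̄_x = −λ·sin z̄, z̄_y = −(1/λ)·sin z̄ (the Bäcklund system with z ≡ 0), and is a solution
of the sine-Gordon equation z̄_{xy} = (1/2)·sin(2z̄). -/
theorem one_soliton_solution (lam c : ℝ) (hlam : lam ≠ 0) :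
    let zbar : ℝ × ℝ → ℝ :=
      fun p => 2 * Real.arctan (Real.exp (-(lam * p.1 + p.2 / lam + c)))
    (∀ p : ℝ × ℝ,
      deriv (fun x => zbar (x, p.2)) p.1 = -lam * Real.sin (zbar p)) ∧
    (∀ p : ℝ × ℝ,
      deriv (fun y => zbar (p.1, y)) p.2 = -(1 / lam) * Real.sin (zbar p)) ∧
    (∀ p : ℝ × ℝ,
      deriv (fun y => deriv (fun x => zbar (x, y)) p.1) p.2
        = (1 / 2) * Real.sin (2 * zbar p)) := by
  intro zbar
  have hx (p : ℝ × ℝ) :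
      HasDerivAt (fun x => zbar (x, p.2)) (-lam * Real.sin (zbar p)) p.1 := by
    refine HasDerivAt.two_mul_arctan_exp (u := fun x => -(lam * x + p.2 / lam + c)) ?_
    exact ((((hasDerivAt_id p.1).const_mul lam).congr_deriv (mul_one lam)).add_const
      (p.2 / lam)).add_const c |>.neg
  have hy (p : ℝ × ℝ) :
      HasDerivAt (fun y => zbar (p.1, y)) (-(1 / lam) * Real.sin (zbar p)) p.2 := by
    refine HasDerivAt.two_mul_arctan_exp (u := fun y => -(lam * p.1 + y / lam + c)) ?_
    exact ((((hasDerivAt_id p.2).div_const lam).const_add (lam * p.1)).add_const c).neg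
  refine ⟨fun p => (hx p).deriv, fun p => (hy p).deriv, fun p => ?_⟩
  have hxy : (fun y => deriv (fun x => zbar (x, y)) p.1) =
      fun y => -lam * Real.sin (zbar (p.1, y)) :=
    funext fun y => (hx (p.1, y)).deriv
  rw [hxy, ((hy p).sin.const_mul (-lam)).deriv, Real.sin_two_mul (zbar p)]
  field_simp
end

section
/- Let λ be a nonzero real constant and let z : ℝ² → ℝ be a smooth solution of the sine-Gordon equation z_{xy} = (1/2)·sin(2z). Then for every point (x₀, y₀) ∈ ℝ² and every value c ∈ ℝ there exist an open neighborhood U of (x₀, y₀) and a smooth function z̄ : U → ℝ with z̄(x₀, y₀) = c satisfying the Bäcklund system z_x + z̄_x = λ·sin(z − z̄) and z_y − z̄_y = (1/λ)·sin(z + z̄) throughout U. (Given a known solution z of sine-Gordon, the Bäcklund system is a compatible overdetermined first-order system for z̄, producing a 1-parameter family of new solutions.) -/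
open Set Metric Filter Topology Asymptotics
open scoped ContDiff

section CommutingFlows

variable {E : Type*} [NormedAddCommGroup E] [NormedSpace ℝ E]

/-- Forward-in-time Grönwall estimate in exponential form. -/
lemma norm_le_mul_exp_of_norm_deriv_le_right {f f' : ℝ → E} {K ε t₀ t : ℝ} (hK : 1 ≤ K)
    (hε : 0 ≤ ε) (ht : t₀ ≤ t) (hf : ∀ τ ∈ Icc t₀ t, HasDerivAt f (f' τ) τ)
    (bound : ∀ τ ∈ Icc t₀ t, ‖f' τ‖ ≤ K * ‖f τ‖ + ε) :
    ‖f t‖ ≤ (‖f t₀‖ + ε) * Real.exp (K * (t - t₀)) := by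
  have h := norm_le_gronwallBound_of_norm_deriv_right_le
    (fun τ hτ ↦ (hf τ hτ).continuousAt.continuousWithinAt)
    (fun τ hτ ↦ (hf τ (Ico_subset_Icc_self hτ)).hasDerivWithinAt) le_rfl
    (fun τ hτ ↦ bound τ (Ico_subset_Icc_self hτ)) t (right_mem_Icc.2 ht)
  rw [gronwallBound_of_K_ne_0 (by positivity)] at h
  have hexp : 1 ≤ Real.exp (K * (t - t₀)) :=
    Real.one_le_exp (mul_nonneg (by positivity) (sub_nonneg.2 ht))
  have hdiv : ε / K ≤ ε := div_le_self hε hK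
  nlinarith [mul_le_mul_of_nonneg_right hdiv (sub_nonneg.2 hexp)]

/-- Two-sided Grönwall estimate in exponential form. -/
lemma norm_le_mul_exp_of_norm_deriv_le {f f' : ℝ → E} {K ε a b t₀ t : ℝ} (hK : 1 ≤ K)
    (hε : 0 ≤ ε) (ht₀ : t₀ ∈ Ioo a b) (ht : t ∈ Ioo a b)
    (hf : ∀ τ ∈ Ioo a b, HasDerivAt f (f' τ) τ)
    (bound : ∀ τ ∈ Ioo a b, ‖f' τ‖ ≤ K * ‖f τ‖ + ε) :
    ‖f t‖ ≤ (‖f t₀‖ + ε) * Real.exp (K * |t - t₀|) := by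
  rcases le_total t₀ t with h | h
  · rw [abs_of_nonneg (sub_nonneg.2 h)]
    have hsub : Icc t₀ t ⊆ Ioo a b := Icc_subset_Ioo ht₀.1 ht.2
    exact norm_le_mul_exp_of_norm_deriv_le_right hK hε h (fun τ hτ ↦ hf τ (hsub hτ))
      (fun τ hτ ↦ bound τ (hsub hτ))
  · have hsub : ∀ τ ∈ Icc (-t₀) (-t), -τ ∈ Ioo a b := fun τ hτ ↦
      ⟨by linarith [ht.1, hτ.2], by linarith [ht₀.2, hτ.1]⟩
    have key := norm_le_mul_exp_of_norm_deriv_le_right (f := fun τ ↦ f (-τ))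
      (f' := fun τ ↦ -f' (-τ)) hK hε (neg_le_neg h)
      (fun τ hτ ↦ by
        simpa [Function.comp_def] using (hf (-τ) (hsub τ hτ)).scomp τ (hasDerivAt_neg τ))
      (fun τ hτ ↦ by simpa using bound (-τ) (hsub τ hτ))
    rw [abs_of_nonpos (sub_nonpos.2 h)]
    simpa [neg_sub, sub_eq_add_neg, add_comm] using key

/-- A quadratic Taylor estimate, uniform on compact convex sets. -/
lemma ContDiff.exists_norm_sub_sub_fderiv_le {F : Type*} [NormedAddCommGroup F] [NormedSpace ℝ F]
    {Y : E → F} (hY : ContDiff ℝ 2 Y) {B : Set E} (hB : IsCompact B) (hconv : Convex ℝ B) :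
    ∃ C, 0 ≤ C ∧ ∀ a ∈ B, ∀ b ∈ B, ‖Y b - Y a - fderiv ℝ Y a (b - a)‖ ≤ C * ‖b - a‖ ^ 2 := by
  have hD : ContDiff ℝ 1 (fderiv ℝ Y) := hY.fderiv_right (by norm_num)
  obtain ⟨C, hC⟩ := hB.exists_bound_of_continuousOn
    (hD.continuous_fderiv one_ne_zero).continuousOn
  refine ⟨max C 0, le_max_right _ _, fun a ha b hb ↦ ?_⟩
  have hseg : segment ℝ a b ⊆ B := hconv.segment_subset ha hb
  have := (convex_segment a b).norm_image_sub_le_of_norm_fderiv_le' (𝕜 := ℝ) (f := Y)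
    (φ := fderiv ℝ Y a) (C := max C 0 * ‖b - a‖)
    (fun x _ ↦ (hY.differentiable two_ne_zero) x)
    (fun x hx ↦ by
      refine (hconv.norm_image_sub_le_of_norm_fderiv_le (𝕜 := ℝ)
        (fun x _ ↦ (hD.differentiable one_ne_zero) x)
        (fun x hx ↦ (hC x hx).trans (le_max_left C 0)) ha (hseg hx)).trans ?_
      gcongr
      exact norm_sub_le_of_mem_segment hx)
    (left_mem_segment ℝ a b) (right_mem_segment ℝ a b)
  rwa [mul_assoc, ← sq] at this

/-- Two commuting vector fields on a finite-dimensional space have a common local integral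
surface through every point. -/
theorem exists_integral_surface_of_commuting [FiniteDimensional ℝ E] {X Y : E → E}
    (hX : ContDiff ℝ 2 X) (hY : ContDiff ℝ 2 Y)
    (hcomm : ∀ q, fderiv ℝ X q (Y q) = fderiv ℝ Y q (X q)) (q₀ : E) (s₀ t₀ : ℝ) :
    ∃ ε > 0, ∃ Φ : ℝ × ℝ → E, Φ (s₀, t₀) = q₀ ∧ ContinuousOn Φ (ball (s₀, t₀) ε) ∧
      ∀ p ∈ ball (s₀, t₀) ε, HasDerivAt (fun s ↦ Φ (s, p.2)) (X (Φ p)) p.1 ∧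
        HasDerivAt (fun t ↦ Φ (p.1, t)) (Y (Φ p)) p.2 := by
  have : CompleteSpace E := FiniteDimensional.complete ℝ E
  have : ProperSpace E := FiniteDimensional.proper ℝ E
  obtain ⟨ε₁, hε₁, a, r, L, K, hr, hpl⟩ :=
    IsPicardLindelof.of_contDiffAt_one ((hY.of_le one_le_two).contDiffAt (x := q₀))
  obtain ⟨α, hα, L', hL'⟩ :=
    (hpl t₀).exists_forall_mem_closedBall_eq_hasDerivWithinAt_lipschitzOnWith
  have hαd : ∀ x ∈ closedBall q₀ r, ∀ t ∈ Ioo (t₀ - ε₁) (t₀ + ε₁),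
      HasDerivAt (α x) (Y (α x t)) t := fun x hx t ht ↦
    ((hα x hx).2 t (Ioo_subset_Icc_self ht)).hasDerivAt (Icc_mem_nhds ht.1 ht.2)
  have hαc : ContinuousOn (Function.uncurry α)
      (closedBall q₀ r ×ˢ Icc (t₀ - ε₁) (t₀ + ε₁)) :=
    continuousOn_prod_of_continuousOn_lipschitzOnWith _ L'
      (fun x hx ↦ HasDerivWithinAt.continuousOn (hα x hx).2) hL'
  obtain ⟨R, hR⟩ : ∃ R, ∀ x ∈ closedBall q₀ r, ∀ t ∈ Icc (t₀ - ε₁) (t₀ + ε₁),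
      α x t ∈ closedBall (0 : E) R := by
    obtain ⟨R, hR⟩ := ((isCompact_closedBall q₀ (r : ℝ)).prod
      isCompact_Icc).exists_bound_of_continuousOn hαc
    exact ⟨R, fun x hx t ht ↦ mem_closedBall_zero_iff.2 (hR (x, t) ⟨hx, ht⟩)⟩
  obtain ⟨C, hC0, hC⟩ := hY.exists_norm_sub_sub_fderiv_le (isCompact_closedBall (0 : E) R)
    (convex_closedBall _ _)
  obtain ⟨M, hM⟩ := (isCompact_closedBall (0 : E) R).exists_bound_of_continuousOn
    (hY.continuous_fderiv two_ne_zero).continuousOn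
  obtain ⟨γ, hγ0, ε₂, hε₂, hγ⟩ :=
    ((hX.of_le one_le_two).contDiffAt
      (x := q₀)).exists_forall_mem_closedBall_exists_eq_forall_mem_Ioo_hasDerivAt₀ s₀
  obtain ⟨ε₃, hε₃, hγr⟩ : ∃ ε₃ > 0, ∀ s ∈ ball s₀ ε₃, γ s ∈ closedBall q₀ r := by
    have hcont : ContinuousAt γ s₀ := (hγ s₀ (by simp [hε₂])).continuousAt
    have : γ ⁻¹' closedBall q₀ r ∈ 𝓝 s₀ :=
      hcont.preimage_mem_nhds (by rw [hγ0]; exact closedBall_mem_nhds q₀ hr)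
    exact Metric.mem_nhds_iff.1 this
  have hmem : ∀ p ∈ ball (s₀, t₀) (min ε₁ (min ε₂ ε₃)),
      p.2 ∈ Ioo (t₀ - ε₁) (t₀ + ε₁) ∧ p.1 ∈ Ioo (s₀ - ε₂) (s₀ + ε₂) ∧ p.1 ∈ ball s₀ ε₃ := by
    intro p hp
    rw [← ball_prod_same, mem_prod] at hp
    simp only [← Real.ball_eq_Ioo]
    exact ⟨ball_subset_ball (min_le_left _ _) hp.2,
      ball_subset_ball ((min_le_right _ _).trans (min_le_left _ _)) hp.1,
      ball_subset_ball ((min_le_right _ _).trans (min_le_right _ _)) hp.1⟩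
  refine ⟨min ε₁ (min ε₂ ε₃), by positivity, fun p ↦ α (γ p.1) p.2, ?_, ?_, ?_⟩
  · dsimp only; rw [hγ0]; exact (hα q₀ (mem_closedBall_self hr.le)).1
  · refine hαc.comp (f := fun p : ℝ × ℝ ↦ (γ p.1, p.2)) ?_ fun p hp ↦
      ⟨hγr _ (hmem p hp).2.2, Ioo_subset_Icc_self (hmem p hp).1⟩
    intro p hp
    have := (hγ p.1 (hmem p hp).2.1).continuousAt
    exact ((this.comp (f := Prod.fst) continuousAt_fst).prodMk
      continuousAt_snd).continuousWithinAt
  rintro ⟨s, t⟩ hp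
  obtain ⟨ht, hs, hs'⟩ := hmem _ hp
  refine ⟨?_, hαd (γ s) (hγr s hs') t ht⟩
  dsimp only at ht hs hs' ⊢
  have ht₀ : t₀ ∈ Ioo (t₀ - ε₁) (t₀ + ε₁) := by simp [hε₁]
  set N : ℝ → ℝ := fun σ ↦ ‖γ σ - γ s - (σ - s) • X (γ s)‖ + C * (L' * ‖γ σ - γ s‖) ^ 2 with hN
  have hNo : N =o[𝓝 s] fun σ ↦ σ - s := by
    refine ((hasDerivAt_iff_isLittleO.1 (hγ s hs)).norm_left).add ?_
    refine IsBigO.trans_isLittleO (g := fun σ ↦ ‖σ - s‖ ^ 2) ?_ (isLittleO_pow_sub_sub s one_lt_two)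
    exact (((hγ s hs).isBigO_sub.norm_norm.const_mul_left _).pow 2).const_mul_left _
  rw [hasDerivAt_iff_isLittleO]
  refine IsBigO.trans_isLittleO ?_ hNo
  refine IsBigO.of_bound (Real.exp (max M 1 * |t - t₀|)) ?_
  filter_upwards [isOpen_ball.mem_nhds hs'] with σ hσ
  have hγs := hγr s hs'
  have hγσ := hγr σ hσ
  have key := norm_le_mul_exp_of_norm_deriv_le (K := max M 1)
    (f := fun τ ↦ α (γ σ) τ - α (γ s) τ - (σ - s) • X (α (γ s) τ))
    (f' := fun τ ↦ Y (α (γ σ) τ) - Y (α (γ s) τ)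
      - (σ - s) • fderiv ℝ X (α (γ s) τ) (Y (α (γ s) τ)))
    (ε := C * (L' * ‖γ σ - γ s‖) ^ 2) (le_max_right _ _) (by positivity) ht₀ ht
    (fun τ hτ ↦ ((hαd _ hγσ τ hτ).sub (hαd _ hγs τ hτ)).sub
      ((((hX.differentiable two_ne_zero) _).hasFDerivAt.comp_hasDerivAt τ
        (hαd _ hγs τ hτ)).const_smul (σ - s)))
    (fun τ hτ ↦ by
      have hτ' := Ioo_subset_Icc_self hτ
      set u := α (γ s) τ
      set v := α (γ σ) τ
      have hlip : ‖v - u‖ ≤ L' * ‖γ σ - γ s‖ := (hL' τ hτ').norm_sub_le hγσ hγs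
      have hsplit : Y v - Y u - (σ - s) • fderiv ℝ X u (Y u)
          = fderiv ℝ Y u (v - u - (σ - s) • X u) + (Y v - Y u - fderiv ℝ Y u (v - u)) := by
        rw [hcomm, map_sub, map_smul]; abel
      rw [hsplit]
      refine (norm_add_le _ _).trans (add_le_add ?_ ?_)
      · exact (ContinuousLinearMap.le_opNorm _ _).trans (by
          gcongr
          exact (hM u (hR _ hγs τ hτ')).trans (le_max_left _ _))
      · exact (hC u (hR _ hγs τ hτ') v (hR _ hγσ τ hτ')).trans (by gcongr))
  simp only [(hα _ hγσ).1, (hα _ hγs).1] at key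
  have hN0 : 0 ≤ N σ := by positivity
  rw [Real.norm_of_nonneg hN0, mul_comm]
  exact key

/-- A solution of a total differential equation `DΦ = A ∘ Φ` with smooth `A` is smooth. -/
lemma contDiffOn_infty_of_hasFDerivAt_comp {D : Type*} [NormedAddCommGroup D] [NormedSpace ℝ D]
    {A : E → D →L[ℝ] E} (hA : ContDiff ℝ ∞ A) {U : Set D} (hU : IsOpen U) {Φ : D → E}
    (hΦ : ∀ p ∈ U, HasFDerivAt Φ (A (Φ p)) p) : ContDiffOn ℝ ∞ Φ U := by
  refine contDiffOn_infty.2 fun n ↦ ?_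
  induction n with
  | zero =>
    exact contDiffOn_zero.2 fun p hp ↦ (hΦ p hp).continuousAt.continuousWithinAt
  | succ n ih =>
    refine (contDiffOn_succ_iff_hasFDerivWithinAt_of_uniqueDiffOn hU.uniqueDiffOn).2
      ⟨fun h ↦ absurd h (WithTop.coe_ne_top (a := (n : ℕ∞))), fun p ↦ A (Φ p), ?_, fun p hp ↦ (hΦ p hp).hasFDerivWithinAt⟩
    exact (hA.of_le (by exact_mod_cast le_top)).comp_contDiffOn ih

/-- Two commuting smooth vector fields on a finite-dimensional space have a common smooth local
integral surface through every point. -/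
theorem exists_smooth_integral_surface_of_commuting [FiniteDimensional ℝ E] {X Y : E → E}
    (hX : ContDiff ℝ ∞ X) (hY : ContDiff ℝ ∞ Y)
    (hcomm : ∀ q, fderiv ℝ X q (Y q) = fderiv ℝ Y q (X q)) (q₀ : E) (p₀ : ℝ × ℝ) :
    ∃ ε > 0, ∃ Φ : ℝ × ℝ → E, Φ p₀ = q₀ ∧ ContDiffOn ℝ ∞ Φ (ball p₀ ε) ∧
      ∀ p ∈ ball p₀ ε, HasFDerivAt Φ ((ContinuousLinearMap.toSpanSingleton ℝ (X (Φ p))).coprod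
        (ContinuousLinearMap.toSpanSingleton ℝ (Y (Φ p)))) p := by
  obtain ⟨ε, hε, Φ, hΦ0, hΦc, hΦ⟩ := exists_integral_surface_of_commuting
    (contDiff_infty.1 hX 2) (contDiff_infty.1 hY 2) hcomm q₀ p₀.1 p₀.2
  let S : E →L[ℝ] ℝ →L[ℝ] E := (ContinuousLinearMap.toSpanSingletonCLE (𝕜 := ℝ) (E := E))
  have hfd : ∀ p ∈ ball p₀ ε, HasFDerivAt Φ ((S (X (Φ p))).coprod (S (Y (Φ p)))) p := by
    intro p hp
    have hnhds := isOpen_ball.mem_nhds hp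
    have hcont : ContinuousAt Φ p := hΦc.continuousAt hnhds
    refine (hasStrictFDerivAt_uncurry_coprod (f := fun s t ↦ Φ (s, t))
      (f₁ := fun s t ↦ S (X (Φ (s, t)))) (f₂ := fun s t ↦ S (Y (Φ (s, t))))
      ?_ ?_ ?_ ?_).hasFDerivAt
    · filter_upwards [hnhds] with v hv using (hΦ v hv).1.hasFDerivAt
    · filter_upwards [hnhds] with v hv using (hΦ v hv).2.hasFDerivAt
    · exact S.continuous.continuousAt.comp (hX.continuous.continuousAt.comp hcont)
    · exact S.continuous.continuousAt.comp (hY.continuous.continuousAt.comp hcont)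
  refine ⟨ε, hε, Φ, hΦ0, contDiffOn_infty_of_hasFDerivAt_comp
    (A := fun q ↦ (S (X q)).coprod (S (Y q))) ?_ isOpen_ball hfd, hfd⟩
  have : (fun q ↦ (S (X q)).coprod (S (Y q))) = fun q ↦
      (S (X q)).comp (.fst ℝ ℝ ℝ) + (S (Y q)).comp (.snd ℝ ℝ ℝ) := by
    ext <;> simp
  rw [this]
  exact ((S.contDiff.comp hX).clm_comp contDiff_const).add
    ((S.contDiff.comp hY).clm_comp contDiff_const)

end CommutingFlows

/-- The planar Frobenius theorem: the system `w_x = F(x, y, w)`, `w_y = G(x, y, w)` satisfying the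
integrability condition has a smooth local solution with any prescribed value at a point. -/
theorem exists_contDiffOn_hasDerivAt_of_integrable {F G : (ℝ × ℝ) × ℝ → ℝ}
    (hF : ContDiff ℝ ∞ F) (hG : ContDiff ℝ ∞ G)
    (hint : ∀ q, fderiv ℝ F q ((0, 1), G q) = fderiv ℝ G q ((1, 0), F q)) (p₀ : ℝ × ℝ) (c : ℝ) :
    ∃ ε > 0, ∃ w : ℝ × ℝ → ℝ, w p₀ = c ∧ ContDiffOn ℝ ∞ w (ball p₀ ε) ∧
      ∀ p ∈ ball p₀ ε, HasDerivAt (fun x ↦ w (x, p.2)) (F (p, w p)) p.1 ∧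
        HasDerivAt (fun y ↦ w (p.1, y)) (G (p, w p)) p.2 := by
  have hderiv : ∀ (v : ℝ × ℝ) {H : (ℝ × ℝ) × ℝ → ℝ}, ContDiff ℝ ∞ H → ∀ q u,
      fderiv ℝ (fun q ↦ (v, H q)) q u = (0, fderiv ℝ H q u) := by
    intro v H hH q u
    have := (hasFDerivAt_const v q).prodMk ((hH.differentiable (by simp)) q).hasFDerivAt
    rw [this.fderiv]; simp
  obtain ⟨ε, hε, Φ, hΦ0, hΦs, hΦ⟩ := exists_smooth_integral_surface_of_commuting
    (X := fun q ↦ ((1, 0), F q)) (Y := fun q ↦ ((0, 1), G q))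
    (contDiff_const.prodMk hF) (contDiff_const.prodMk hG)
    (fun q ↦ by rw [hderiv _ hF, hderiv _ hG, hint]) (p₀, c) p₀
  have hfst : ∀ p ∈ ball p₀ ε, (Φ p).1 = p := by
    intro p hp
    have hd : ∀ p ∈ ball p₀ ε, HasFDerivAt (fun p ↦ (Φ p).1 - p) (0 : ℝ × ℝ →L[ℝ] ℝ × ℝ) p := by
      intro p hp
      have h : HasFDerivAt (fun p ↦ (Φ p).1) _ p := (hΦ p hp).fst
      exact (h.sub (hasFDerivAt_id p)).congr_fderiv (by ext <;> simp)
    have := isOpen_ball.is_const_of_fderiv_eq_zero (𝕜 := ℝ)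
      (convex_ball p₀ ε).isPreconnected
      (fun p hp ↦ (hd p hp).differentiableAt.differentiableWithinAt)
      (fun p hp ↦ (hd p hp).fderiv) hp (mem_ball_self hε)
    simpa [hΦ0, sub_eq_zero] using this
  refine ⟨ε, hε, fun p ↦ (Φ p).2, by simp [hΦ0], contDiff_snd.comp_contDiffOn hΦs,
    fun p hp ↦ ?_⟩
  have hpair : (p, (Φ p).2) = Φ p := Prod.ext (hfst p hp).symm rfl
  rw [hpair]
  have h := (hΦ p hp).snd
  constructor
  · simpa [Function.comp_def] using h.comp_hasDerivAt (x := p.1) (f := fun x ↦ (x, p.2))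
      ((hasDerivAt_id p.1).prodMk (hasDerivAt_const p.1 p.2))
  · simpa [Function.comp_def] using h.comp_hasDerivAt (x := p.2) (f := fun y ↦ (p.1, y))
      ((hasDerivAt_const p.2 p.1).prodMk (hasDerivAt_id p.2))


/-- Given a smooth solution z of the sine-Gordon equation, through every point
and every initial value c there is a local smooth solution z̄ of the Bäcklund system. -/
theorem backlund_local_solvability
    (lam : ℝ) (hlam : lam ≠ 0) (z : ℝ × ℝ → ℝ) (hz : ContDiff ℝ (⊤ : ℕ∞) z)
    (hSG : ∀ p : ℝ × ℝ,
      deriv (fun y => deriv (fun x => z (x, y)) p.1) p.2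
        = (1 / 2) * Real.sin (2 * z p)) :
    ∀ p₀ : ℝ × ℝ, ∀ c : ℝ, ∃ U : Set (ℝ × ℝ), IsOpen U ∧ p₀ ∈ U ∧
      ∃ zbar : ℝ × ℝ → ℝ, ContDiffOn ℝ (⊤ : ℕ∞) zbar U ∧ zbar p₀ = c ∧
        (∀ p ∈ U,
          deriv (fun x => z (x, p.2)) p.1 + deriv (fun x => zbar (x, p.2)) p.1
            = lam * Real.sin (z p - zbar p)) ∧
        (∀ p ∈ U,
          deriv (fun y => z (p.1, y)) p.2 - deriv (fun y => zbar (p.1, y)) p.2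
            = (1 / lam) * Real.sin (z p + zbar p)) := by
  intro p₀ c
  have hz2 : ∀ p, DifferentiableAt ℝ (fderiv ℝ z) p := fun p ↦
    ((contDiff_infty.1 hz 2).fderiv_right (m := 1) (by norm_num)).differentiable one_ne_zero p
  have hzd : ∀ p, HasFDerivAt z (fderiv ℝ z p) p := fun p ↦
    (hz.differentiable (by simp) p).hasFDerivAt
  have hzx : ∀ p : ℝ × ℝ, deriv (fun x ↦ z (x, p.2)) p.1 = fderiv ℝ z p (1, 0) := fun p ↦
    ((hzd p).comp_hasDerivAt (x := p.1) (f := fun x ↦ (x, p.2))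
      ((hasDerivAt_id p.1).prodMk (hasDerivAt_const p.1 p.2))).deriv
  have hzy : ∀ p : ℝ × ℝ, deriv (fun y ↦ z (p.1, y)) p.2 = fderiv ℝ z p (0, 1) := fun p ↦
    ((hzd p).comp_hasDerivAt (x := p.2) (f := fun y ↦ (p.1, y))
      ((hasDerivAt_const p.2 p.1).prodMk (hasDerivAt_id p.2))).deriv
  have hzv : ∀ p v, HasFDerivAt (fun p ↦ fderiv ℝ z p v)
      ((fderiv ℝ (fderiv ℝ z) p).flip v) p := fun p v ↦ by
    simpa using (hz2 p).hasFDerivAt.clm_apply (hasFDerivAt_const v p)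
  have hzxy : ∀ p, fderiv ℝ (fderiv ℝ z) p (0, 1) (1, 0) = 1 / 2 * Real.sin (2 * z p) := fun p ↦ by
    rw [← hSG p]
    have := ((hzv p (1, 0)).comp_hasDerivAt (x := p.2) (f := fun y ↦ (p.1, y))
      ((hasDerivAt_const p.2 p.1).prodMk (hasDerivAt_id p.2))).deriv
    simpa [Function.comp_def, ← hzx] using this.symm
  have hsymm : ∀ p, fderiv ℝ (fderiv ℝ z) p (1, 0) (0, 1)
      = fderiv ℝ (fderiv ℝ z) p (0, 1) (1, 0) := fun p ↦
    ((contDiff_infty.1 hz 2).contDiffAt.isSymmSndFDerivAt (by simp)) _ _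
  have hzs : ∀ v, ContDiff ℝ ∞ fun q : (ℝ × ℝ) × ℝ ↦ fderiv ℝ z q.1 v := fun v ↦
    ((hz.fderiv_right (m := ∞) (by simp)).comp contDiff_fst).clm_apply contDiff_const
  have hzf : ContDiff ℝ ∞ fun q : (ℝ × ℝ) × ℝ ↦ z q.1 := hz.comp contDiff_fst
  have hint : ∀ q : (ℝ × ℝ) × ℝ,
      fderiv ℝ (fun q : (ℝ × ℝ) × ℝ ↦ lam * Real.sin (z q.1 - q.2) - fderiv ℝ z q.1 (1, 0)) q
          ((0, 1), fderiv ℝ z q.1 (0, 1) - 1 / lam * Real.sin (z q.1 + q.2))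
        = fderiv ℝ (fun q : (ℝ × ℝ) × ℝ ↦
            fderiv ℝ z q.1 (0, 1) - 1 / lam * Real.sin (z q.1 + q.2)) q
          ((1, 0), lam * Real.sin (z q.1 - q.2) - fderiv ℝ z q.1 (1, 0)) := by
    rintro ⟨p, u⟩
    have hz1 : HasFDerivAt (fun q : (ℝ × ℝ) × ℝ ↦ z q.1) _ (p, u) :=
      (hzd p).comp (p, u) hasFDerivAt_fst
    have hz1v : ∀ v, HasFDerivAt (fun q : (ℝ × ℝ) × ℝ ↦ fderiv ℝ z q.1 v)
        ((fderiv ℝ (fderiv ℝ z) p).flip v ∘L .fst ℝ (ℝ × ℝ) ℝ) (p, u) := fun v ↦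
      HasFDerivAt.comp (g := fun p ↦ fderiv ℝ z p v) (p, u) (hzv p v) hasFDerivAt_fst
    have hsnd : HasFDerivAt (fun q : (ℝ × ℝ) × ℝ ↦ q.2) (.snd ℝ (ℝ × ℝ) ℝ) (p, u) :=
      hasFDerivAt_snd
    have hF := ((hz1.fun_sub hsnd).sin.const_mul lam).fun_sub (hz1v (1, 0))
    have hG := (hz1v (0, 1)).fun_sub ((hz1.fun_add hsnd).sin.const_mul (1 / lam))
    rw [hF.fderiv, hG.fderiv]
    have htrig : Real.sin (2 * z p) = Real.sin (z p + u) * Real.cos (z p - u)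
        + Real.cos (z p + u) * Real.sin (z p - u) := by
      rw [← Real.sin_add]; ring_nf
    simp [hsymm, hzxy, htrig]
    field_simp
    ring
  obtain ⟨ε, hε, w, hw0, hws, hw⟩ := exists_contDiffOn_hasDerivAt_of_integrable
    (F := fun q ↦ lam * Real.sin (z q.1 - q.2) - fderiv ℝ z q.1 (1, 0))
    (G := fun q ↦ fderiv ℝ z q.1 (0, 1) - 1 / lam * Real.sin (z q.1 + q.2))
    ((contDiff_const.mul (hzf.sub contDiff_snd).sin).sub (hzs _))
    ((hzs _).sub (contDiff_const.mul (hzf.add contDiff_snd).sin)) hint p₀ c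
  refine ⟨ball p₀ ε, isOpen_ball, mem_ball_self hε, w, hws, hw0, fun p hp ↦ ?_, fun p hp ↦ ?_⟩
  · rw [(hw p hp).1.deriv, hzx]; ring
  · rw [(hw p hp).2.deriv, hzy]; ring
end

section
/- Let U ⊆ ℝ² be open, let λ be a nonzero real constant, and let z, z̄ : U → ℝ be C² functions satisfying z̄_x − z_x = √2·λ·exp((z̄ + z)/2) and z̄_y + z_y = (√2/λ)·exp((z̄ − z)/2) at every point of U. Then z satisfies the wave equation z_{xy} = 0 and z̄ satisfies Liouville's equation z̄_{xy} = e^{z̄} on U. (This is the classical Bäcklund transformation between the wave equation and Liouville's equation, arising in Case 3B of the classification of homogeneous Bäcklund transformations.) -/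
section PartialDerivatives

open Topology

variable {E : Type*} [NormedAddCommGroup E] [NormedSpace ℝ E]

theorem HasFDerivAt.hasDerivAt_partial_fst {f : ℝ × ℝ → E} {f' : ℝ × ℝ →L[ℝ] E} {p : ℝ × ℝ}
    (hf : HasFDerivAt f f' p) : HasDerivAt (fun x => f (x, p.2)) (f' (1, 0)) p.1 :=
  HasFDerivAt.comp_hasDerivAt (f := fun x => (x, p.2)) p.1 hf
    ((hasDerivAt_id p.1).prodMk (hasDerivAt_const p.1 p.2))

theorem HasFDerivAt.hasDerivAt_partial_snd {f : ℝ × ℝ → E} {f' : ℝ × ℝ →L[ℝ] E} {p : ℝ × ℝ}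
    (hf : HasFDerivAt f f' p) : HasDerivAt (fun y => f (p.1, y)) (f' (0, 1)) p.2 :=
  HasFDerivAt.comp_hasDerivAt (f := fun y => (p.1, y)) p.2 hf
    ((hasDerivAt_const p.2 p.1).prodMk (hasDerivAt_id p.2))

theorem Filter.Eventually.prodMk_right {P : ℝ × ℝ → Prop} {p : ℝ × ℝ} (h : ∀ᶠ q in 𝓝 p, P q) :
    ∀ᶠ y in 𝓝 p.2, P (p.1, y) :=
  (Continuous.prodMk_right p.1).continuousAt.eventually h

theorem Filter.Eventually.prodMk_left {P : ℝ × ℝ → Prop} {p : ℝ × ℝ} (h : ∀ᶠ q in 𝓝 p, P q) :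
    ∀ᶠ x in 𝓝 p.1, P (x, p.2) :=
  (Continuous.prodMk_left p.2).continuousAt.eventually h

/-- Both iterated mixed partial derivatives of a `C²` function exist, with a common value. -/
theorem ContDiffAt.exists_hasDerivAt_mixed_partial {f : ℝ × ℝ → E} {p : ℝ × ℝ}
    (hf : ContDiffAt ℝ 2 f p) :
    ∃ m, HasDerivAt (fun y => deriv (fun x => f (x, y)) p.1) m p.2 ∧
      HasDerivAt (fun x => deriv (fun y => f (x, y)) p.2) m p.1 := by
  have hdiff : ∀ᶠ q in 𝓝 p, DifferentiableAt ℝ f q :=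
    (hf.eventually (by simp)).mono fun q hq => hq.differentiableAt (by simp)
  have hsecond : HasFDerivAt (fderiv ℝ f) (fderiv ℝ (fderiv ℝ f) p) p :=
    ((hf.fderiv_right (m := 1) (by norm_num)).differentiableAt (by simp)).hasFDerivAt
  have hsymm : IsSymmSndFDerivAt ℝ f p := hf.isSymmSndFDerivAt (by simp)
  refine ⟨fderiv ℝ (fderiv ℝ f) p (0, 1) (1, 0), ?_, ?_⟩
  · have h := hsecond.hasDerivAt_partial_snd.clm_apply (hasDerivAt_const p.2 ((1 : ℝ), (0 : ℝ)))
    simp only [map_zero, add_zero] at h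
    exact h.congr_of_eventuallyEq <| hdiff.prodMk_right.mono fun y hy =>
      hy.hasFDerivAt.hasDerivAt_partial_fst.deriv
  · have h := hsecond.hasDerivAt_partial_fst.clm_apply (hasDerivAt_const p.1 ((0 : ℝ), (1 : ℝ)))
    simp only [map_zero, add_zero] at h
    rw [hsymm.eq (0, 1) (1, 0)]
    exact h.congr_of_eventuallyEq <| hdiff.prodMk_left.mono fun x hx =>
      hx.hasFDerivAt.hasDerivAt_partial_snd.deriv

end PartialDerivatives

/-- If a pair (z, z̄) of C² functions on an open set U ⊆ ℝ² satisfies the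
wave–Liouville Bäcklund system z̄_x − z_x = √2·λ·e^{(z̄+z)/2}, z̄_y + z_y = (√2/λ)·e^{(z̄−z)/2},
then z solves the wave equation z_{xy} = 0 and z̄ solves Liouville's equation z̄_{xy} = e^{z̄}. -/
theorem backlund_wave_liouville
    (U : Set (ℝ × ℝ)) (hU : IsOpen U) (lam : ℝ) (hlam : lam ≠ 0)
    (z zbar : ℝ × ℝ → ℝ)
    (hz : ContDiffOn ℝ 2 z U) (hzbar : ContDiffOn ℝ 2 zbar U)
    (hBx : ∀ p ∈ U,
      deriv (fun x => zbar (x, p.2)) p.1 - deriv (fun x => z (x, p.2)) p.1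
        = Real.sqrt 2 * lam * Real.exp ((zbar p + z p) / 2))
    (hBy : ∀ p ∈ U,
      deriv (fun y => zbar (p.1, y)) p.2 + deriv (fun y => z (p.1, y)) p.2
        = (Real.sqrt 2 / lam) * Real.exp ((zbar p - z p) / 2)) :
    (∀ p ∈ U, deriv (fun y => deriv (fun x => z (x, y)) p.1) p.2 = 0) ∧
    (∀ p ∈ U,
      deriv (fun y => deriv (fun x => zbar (x, y)) p.1) p.2 = Real.exp (zbar p)) := by
  suffices h : ∀ p ∈ U, deriv (fun y => deriv (fun x => z (x, y)) p.1) p.2 = 0 ∧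
      deriv (fun y => deriv (fun x => zbar (x, y)) p.1) p.2 = Real.exp (zbar p) from
    ⟨fun p hp => (h p hp).1, fun p hp => (h p hp).2⟩
  intro p hp
  have hpU := hU.mem_nhds hp
  have hzp := hz.contDiffAt hpU
  have hbp := hzbar.contDiffAt hpU
  have hdz := (hzp.differentiableAt (by simp)).hasFDerivAt
  have hdb := (hbp.differentiableAt (by simp)).hasFDerivAt
  have hzx := hdz.hasDerivAt_partial_fst
  have hzy := hdz.hasDerivAt_partial_snd
  have hbx := hdb.hasDerivAt_partial_fst
  have hby := hdb.hasDerivAt_partial_snd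
  have hx := hBx p hp
  have hy := hBy p hp
  rw [hbx.deriv, hzx.deriv] at hx
  rw [hby.deriv, hzy.deriv] at hy
  obtain ⟨a, hay, hax⟩ := hzp.exists_hasDerivAt_mixed_partial
  obtain ⟨b, hby', hbx'⟩ := hbp.exists_hasDerivAt_mixed_partial
  have hsqrt : Real.sqrt 2 * Real.sqrt 2 = 2 := Real.mul_self_sqrt (by norm_num)
  have hexp : Real.exp ((zbar p + z p) / 2) * Real.exp ((zbar p - z p) / 2)
      = Real.exp (zbar p) := by
    rw [← Real.exp_add]
    ring_nf
  have hcoef : Real.sqrt 2 * lam * (Real.sqrt 2 / lam) = 2 := by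
    field_simp
    linarith
  have hsub : b - a = Real.exp (zbar p) := by
    have h := (((hby.add hzy).div_const 2).exp.const_mul (Real.sqrt 2 * lam))
    have hev : (fun y => deriv (fun x => zbar (x, y)) p.1 - deriv (fun x => z (x, y)) p.1)
        =ᶠ[nhds p.2] fun y => Real.sqrt 2 * lam * Real.exp ((zbar (p.1, y) + z (p.1, y)) / 2) :=
      (Filter.Eventually.prodMk_right hpU).mono fun y hy => hBx (p.1, y) hy
    refine ((hby'.sub hay).unique (h.congr_of_eventuallyEq hev)).trans ?_
    simp only [Pi.add_apply, Prod.mk.eta]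
    rw [hy]
    linear_combination
      (Real.exp ((zbar p + z p) / 2) * Real.exp ((zbar p - z p) / 2) / 2) * hcoef + hexp
  have hadd : b + a = Real.exp (zbar p) := by
    have h := (((hbx.sub hzx).div_const 2).exp.const_mul (Real.sqrt 2 / lam))
    have hev : (fun x => deriv (fun y => zbar (x, y)) p.2 + deriv (fun y => z (x, y)) p.2)
        =ᶠ[nhds p.1] fun x => Real.sqrt 2 / lam * Real.exp ((zbar (x, p.2) - z (x, p.2)) / 2) :=
      (Filter.Eventually.prodMk_left hpU).mono fun x hx => hBy (x, p.2) hx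
    refine ((hbx'.add hax).unique (h.congr_of_eventuallyEq hev)).trans ?_
    simp only [Pi.sub_apply, Prod.mk.eta]
    rw [hx]
    linear_combination
      (Real.exp ((zbar p + z p) / 2) * Real.exp ((zbar p - z p) / 2) / 2) * hcoef + hexp
  rw [hay.deriv, hby'.deriv]
  constructor <;> linarith
end

section
/- Let B1, B3 be real numbers with B1 ≠ 0 and B3 ≠ 0. Then Q⁻(B1,B3) = 0 if and only if there exists a real number t with t ≠ 0 and t ≠ −1 such that B1 = −(1/2)·(t + 1)² and B3 = (1/2)·(1/t + 1)². In particular, the zero locus of Q⁻ in the region B1·B3 ≠ 0 is contained in the quadrant B1 < 0, B3 > 0. -/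
/-- For B1, B3 ≠ 0, Q⁻(B1,B3) = 0 iff B1 = −(1/2)(t+1)², B3 = (1/2)(1/t+1)²
for some t ≠ 0, −1; in particular the zero locus lies in the quadrant B1 < 0, B3 > 0. -/
theorem Qminus_zero_locus (B1 B3 : ℝ) (hB1 : B1 ≠ 0) (hB3 : B3 ≠ 0) :
    (4 * B1 ^ 2 * B3 ^ 2 - 4 * B1 ^ 2 * B3 + 4 * B1 * B3 ^ 2
        + B1 ^ 2 + 2 * B1 * B3 + B3 ^ 2 = 0 ↔
      ∃ t : ℝ, t ≠ 0 ∧ t ≠ -1 ∧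
        B1 = -(1 / 2) * (t + 1) ^ 2 ∧ B3 = (1 / 2) * (1 / t + 1) ^ 2) ∧
    (4 * B1 ^ 2 * B3 ^ 2 - 4 * B1 ^ 2 * B3 + 4 * B1 * B3 ^ 2
        + B1 ^ 2 + 2 * B1 * B3 + B3 ^ 2 = 0 → B1 < 0 ∧ B3 > 0) := by
  have forward : 4 * B1 ^ 2 * B3 ^ 2 - 4 * B1 ^ 2 * B3 + 4 * B1 * B3 ^ 2
        + B1 ^ 2 + 2 * B1 * B3 + B3 ^ 2 = 0 →
      ∃ t : ℝ, t ≠ 0 ∧ t ≠ -1 ∧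
        B1 = -(1 / 2) * (t + 1) ^ 2 ∧ B3 = (1 / 2) * (1 / t + 1) ^ 2 := by
    intro h
    have hn : (2 * B1 * B3 + (B1 + B3)) ^ 2 = 8 * B1 ^ 2 * B3 := by linear_combination h
    have hd : (2 * B1 * B3 - (B1 + B3)) ^ 2 = -8 * B1 * B3 ^ 2 := by linear_combination h
    have hn0 : 2 * B1 * B3 + (B1 + B3) ≠ 0 := by
      intro h0
      rw [h0] at hn
      have : 8 * B1 ^ 2 * B3 ≠ 0 := by positivity
      exact this (by linarith)
    have hd0 : 2 * B1 * B3 - (B1 + B3) ≠ 0 := by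
      intro h0
      rw [h0] at hd
      have : 8 * B1 * B3 ^ 2 ≠ 0 := by positivity
      exact this (by linarith)
    have ht : (2 * B1 * B3 + (B1 + B3)) / (2 * B1 * B3 - (B1 + B3)) + 1
        = 4 * B1 * B3 / (2 * B1 * B3 - (B1 + B3)) := by
      rw [div_add_one hd0]
      ring
    have ht' : 1 / ((2 * B1 * B3 + (B1 + B3)) / (2 * B1 * B3 - (B1 + B3))) + 1
        = 4 * B1 * B3 / (2 * B1 * B3 + (B1 + B3)) := by
      rw [one_div_div, div_add_one hn0]
      ring
    refine ⟨(2 * B1 * B3 + (B1 + B3)) / (2 * B1 * B3 - (B1 + B3)),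
      div_ne_zero hn0 hd0, ?_, ?_, ?_⟩
    · intro h1
      rw [h1, neg_add_cancel] at ht
      have : 4 * B1 * B3 / (2 * B1 * B3 - (B1 + B3)) ≠ 0 := div_ne_zero (by positivity) hd0
      exact this ht.symm
    · rw [ht, div_pow, hd]
      field_simp
      ring
    · rw [ht', div_pow, hn]
      field_simp
      ring
  refine ⟨⟨forward, ?_⟩, fun h => ?_⟩
  · rintro ⟨t, ht, -, rfl, rfl⟩
    field_simp
    ring
  · obtain ⟨t, -, -, h1, h3⟩ := forward h
    refine ⟨lt_of_le_of_ne ?_ hB1, lt_of_le_of_ne ?_ hB3.symm⟩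
    · rw [h1]
      linarith [sq_nonneg (t + 1)]
    · rw [h3]
      positivity
end
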